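/- arXiv:1412.1563 — 2 statements merged into one kernel-verified Lean document; each statement's English description precedes it below -/
import Mathlib

section
/- Let x_{N,1} > x_{N,2} > … > x_{N,N} be, for each N ≥ 3, the unique strictly decreasing zero-mean solution of the recursion. Then the empirical distributions 𝕡_N converge weakly, as N → ∞, to the standard Gaussian distribution N(0,1). -/
open Finset

/-- Partial sum `S_n = x_1 + ... + x_n`. -/
noncomputable def S (x : ℕ → ℝ) (n : ℕ) : ℝ := ∑ i ∈ Finset.Icc 1 n, x i

/-- `x_1, ..., x_N` is a solution of the recursion `x_{n+1} = x_n - 1/S_n`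
with all relevant partial sums nonzero. -/
def IsSolution (N : ℕ) (x : ℕ → ℝ) : Prop :=
  ∀ n, 1 ≤ n → n ≤ N - 1 → S x n ≠ 0 ∧ x (n + 1) = x n - 1 / S x n

/-- Zero-median property: the middle value is `0` when `N` is odd, and the two middle
values are negatives of each other when `N` is even. -/
def ZeroMedian (N : ℕ) (x : ℕ → ℝ) : Prop :=
  (Odd N → x ((N + 1) / 2) = 0) ∧ (Even N → x (N / 2) = - x (N / 2 + 1))
open MeasureTheory ProbabilityTheory Filter

open scoped ENNReal

/-- Summation by parts for the partial sums `S x`. -/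
theorem sum_Icc_smul_eq_sum_S_smul {E : Type*} [AddCommGroup E] [Module ℝ E]
    (x : ℕ → ℝ) (g : ℕ → E) (M : ℕ) (hM : 1 ≤ M) :
    ∑ i ∈ Finset.Icc 1 M, x i • g i =
      ∑ n ∈ Finset.Ico 1 M, S x n • (g n - g (n + 1)) + S x M • g M := by
  induction M, hM using Nat.le_induction with
  | base => simp [S]
  | succ M hM ih =>
    have hS : S x (M + 1) = S x M + x (M + 1) := Finset.sum_Icc_succ_top (by omega) _
    rw [Finset.sum_Icc_succ_top (by omega), Finset.sum_Ico_succ_top hM, ih, hS]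
    module

theorem norm_one_sub_exp_neg_mul_I_sub_le (a : ℝ) :
    ‖1 - Complex.exp (-(a * Complex.I)) - a * Complex.I‖ ≤ 2 * a ^ 2 := by
  have hn : ‖-((a : ℂ) * Complex.I)‖ = |a| := by simp
  have hrw : 1 - Complex.exp (-(a * Complex.I)) - a * Complex.I =
      -(Complex.exp (-(a * Complex.I)) - 1 - -(a * Complex.I)) := by ring
  rw [hrw, norm_neg]
  rcases le_total |a| 1 with h | h
  · have := Complex.norm_exp_sub_one_sub_id_le (hn.trans_le h)
    rw [hn, sq_abs] at this
    nlinarith [sq_nonneg a]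
  · have h1 : ‖Complex.exp (-(a * Complex.I)) - 1‖ ≤ |a| := by
      have := Real.norm_exp_I_mul_ofReal_sub_one_le (x := -a)
      rw [norm_neg, Real.norm_eq_abs] at this
      convert this using 4
      push_cast
      ring
    have h2 := norm_sub_le (Complex.exp (-(a * Complex.I)) - 1) (-(a * Complex.I))
    rw [hn] at h2
    nlinarith [sq_abs a]

section ZeroMeanSolution

variable {N : ℕ} {x : ℕ → ℝ}

theorem IsSolution.S_mul_sub (hsol : IsSolution N x) {n : ℕ} (hn : n ∈ Finset.Ico 1 N) :
    S x n * (x n - x (n + 1)) = 1 := by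
  rw [Finset.mem_Ico] at hn
  obtain ⟨h0, h1⟩ := hsol n hn.1 (by omega)
  rw [h1, sub_sub_cancel, mul_one_div_cancel h0]

/-- The second moment of a zero-mean solution. -/
theorem IsSolution.sum_sq (hsol : IsSolution N x) (hN : 1 ≤ N)
    (hmean : ∑ i ∈ Finset.Icc 1 N, x i = 0) :
    ∑ i ∈ Finset.Icc 1 N, x i ^ 2 = N - 1 := by
  have h := sum_Icc_smul_eq_sum_S_smul x x N hN
  have hS : S x N = 0 := hmean
  simp only [smul_eq_mul, hS, zero_mul, add_zero] at h
  rw [Finset.sum_congr rfl fun n hn => hsol.S_mul_sub hn] at h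
  simp only [pow_two, h, Finset.sum_const, Nat.card_Ico, nsmul_eq_mul, mul_one]
  push_cast [hN]
  rfl

theorem IsSolution.abs_le_sqrt (hsol : IsSolution N x) (hN : 1 ≤ N)
    (hmean : ∑ i ∈ Finset.Icc 1 N, x i = 0) {n : ℕ} (hn : n ∈ Finset.Icc 1 N) :
    |x n| ≤ √N := by
  apply Real.abs_le_sqrt
  have := Finset.single_le_sum (f := fun i => x i ^ 2) (fun i _ => sq_nonneg _) hn
  linarith [hsol.sum_sq hN hmean]

theorem IsSolution.sub_le_two_mul_sqrt (hsol : IsSolution N x) (hN : 1 ≤ N)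
    (hmean : ∑ i ∈ Finset.Icc 1 N, x i = 0) : x 1 - x N ≤ 2 * √N := by
  have h1 := abs_le.1 (hsol.abs_le_sqrt hN hmean (Finset.left_mem_Icc.2 hN))
  have h2 := abs_le.1 (hsol.abs_le_sqrt hN hmean (Finset.right_mem_Icc.2 hN))
  linarith

/-- The approximate Stein identity `E[X g(X)] ≈ E[g'(X)]` for `g(y) = exp(i t y)`. -/
theorem IsSolution.norm_stein_exp_le (hsol : IsSolution N x) (hN : 1 ≤ N)
    (hdec : ∀ n, 1 ≤ n → n < N → x (n + 1) < x n)
    (hmean : ∑ i ∈ Finset.Icc 1 N, x i = 0) (t : ℝ) :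
    ‖∑ n ∈ Finset.Icc 1 N, x n • Complex.exp (t * x n * Complex.I) -
        t * Complex.I * ∑ n ∈ Finset.Icc 1 N, Complex.exp (t * x n * Complex.I)‖ ≤
      4 * t ^ 2 * √N + |t| := by
  have hS : S x N = 0 := hmean
  have hsplit : ∑ n ∈ Finset.Icc 1 N, Complex.exp (t * x n * Complex.I) =
      ∑ n ∈ Finset.Ico 1 N, Complex.exp (t * x n * Complex.I) +
        Complex.exp (t * x N * Complex.I) := by
    rw [← Finset.Ico_succ_right_eq_Icc, Order.succ_eq_add_one, Finset.sum_Ico_succ_top hN]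
  have hterm : ∀ n ∈ Finset.Ico 1 N,
      ‖S x n • (Complex.exp (t * x n * Complex.I) - Complex.exp (t * x (n + 1) * Complex.I)) -
        t * Complex.I * Complex.exp (t * x n * Complex.I)‖ ≤
      2 * t ^ 2 * (x n - x (n + 1)) := by
    intro n hn
    have hSd := hsol.S_mul_sub hn
    have hd : 0 < x n - x (n + 1) := by
      rw [Finset.mem_Ico] at hn
      exact sub_pos.2 (hdec n hn.1 hn.2)
    have hSpos : 0 < S x n := pos_of_mul_pos_left (hSd ▸ one_pos) hd.le
    have hexp : Complex.exp (t * x (n + 1) * Complex.I) = Complex.exp (t * x n * Complex.I) *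
        Complex.exp (-((t * (x n - x (n + 1)) : ℝ) * Complex.I)) := by
      rw [← Complex.exp_add]
      push_cast
      ring_nf
    have hSdC : (S x n : ℂ) * (x n - x (n + 1)) = 1 := mod_cast hSd
    have hfactor : S x n • (Complex.exp (t * x n * Complex.I) -
          Complex.exp (t * x (n + 1) * Complex.I)) -
        t * Complex.I * Complex.exp (t * x n * Complex.I) =
        S x n * (Complex.exp ((t * x n : ℝ) * Complex.I) *
          (1 - Complex.exp (-((t * (x n - x (n + 1)) : ℝ) * Complex.I)) -
            (t * (x n - x (n + 1)) : ℝ) * Complex.I)) := by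
      rw [hexp, Complex.real_smul]
      push_cast
      linear_combination (t * Complex.I * Complex.exp (t * x n * Complex.I)) * hSdC
    rw [hfactor, norm_mul, norm_mul, Complex.norm_exp_ofReal_mul_I, one_mul,
      Complex.norm_of_nonneg hSpos.le]
    calc _ ≤ S x n * (2 * (t * (x n - x (n + 1))) ^ 2) := by
          gcongr
          exact norm_one_sub_exp_neg_mul_I_sub_le _
      _ = 2 * t ^ 2 * (x n - x (n + 1)) * (S x n * (x n - x (n + 1))) := by ring
      _ = _ := by rw [hSd, mul_one]
  have htel : ∑ n ∈ Finset.Ico 1 N, (x n - x (n + 1)) = x 1 - x N := by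
    have := Finset.sum_Ico_sub x hN
    rw [← neg_sub (x N), ← this, ← Finset.sum_neg_distrib]
    simp
  rw [sum_Icc_smul_eq_sum_S_smul x _ N hN, hS, zero_smul, add_zero, hsplit, mul_add, ← sub_sub,
    Finset.mul_sum, ← Finset.sum_sub_distrib]
  refine (norm_sub_le _ _).trans (add_le_add ?_ ?_)
  · refine (norm_sum_le_of_le _ hterm).trans ?_
    rw [← Finset.mul_sum, htel]
    nlinarith [hsol.sub_le_two_mul_sqrt hN hmean, sq_nonneg t]
  · have := Complex.norm_exp_ofReal_mul_I (t * x N)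
    push_cast at this
    simp [this]

/-- Quantitative comparison of the characteristic function with that of the Gaussian. -/
theorem IsSolution.norm_sum_exp_mul_sub_le (hsol : IsSolution N x) (hN : 1 ≤ N)
    (hdec : ∀ n, 1 ≤ n → n < N → x (n + 1) < x n)
    (hmean : ∑ i ∈ Finset.Icc 1 N, x i = 0) (t : ℝ) :
    ‖(∑ n ∈ Finset.Icc 1 N, Complex.exp (t * x n * Complex.I)) * Real.exp (t ^ 2 / 2) - N‖ ≤
      (4 * t ^ 2 * √N + |t|) * Real.exp (t ^ 2 / 2) * |t| := by
  have hderivA : ∀ s : ℝ, HasDerivAt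
      (fun u : ℝ => ∑ n ∈ Finset.Icc 1 N, Complex.exp (u * x n * Complex.I))
      (Complex.I * ∑ n ∈ Finset.Icc 1 N, x n • Complex.exp (s * x n * Complex.I)) s := by
    intro s
    rw [Finset.mul_sum]
    refine HasDerivAt.fun_sum fun n _ => ?_
    have h := (((Complex.ofRealCLM.hasDerivAt (x := s)).mul_const (x n : ℂ)).mul_const
      Complex.I).cexp
    simp only [Complex.ofRealCLM_apply, Complex.ofReal_one, one_mul] at h
    convert! h using 1
    rw [Complex.real_smul]
    ring
  have hderivE : ∀ s : ℝ, HasDerivAt (fun u : ℝ => ((Real.exp (u ^ 2 / 2) : ℝ) : ℂ))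
      ((Real.exp (s ^ 2 / 2) * s : ℝ) : ℂ) s := by
    intro s
    have h := (((hasDerivAt_id s).pow 2).div_const 2).exp
    convert! h.ofReal_comp using 1
    simp
  have hmvt := Convex.norm_image_sub_le_of_norm_hasDerivWithin_le
    (s := Metric.closedBall (0 : ℝ) |t|) (x := 0) (y := t)
    (C := (4 * t ^ 2 * √N + |t|) * Real.exp (t ^ 2 / 2))
    (fun s _ => ((hderivA s).mul (hderivE s)).hasDerivWithinAt) ?_ (convex_closedBall _ _)
    (by simp) (by simp)
  · simpa using hmvt
  intro s hs
  have hs' : |s| ≤ |t| := by simpa using hs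
  have hfactor : Complex.I * (∑ n ∈ Finset.Icc 1 N, x n • Complex.exp (s * x n * Complex.I)) *
        (Real.exp (s ^ 2 / 2) : ℝ) +
      (∑ n ∈ Finset.Icc 1 N, Complex.exp (s * x n * Complex.I)) *
        (Real.exp (s ^ 2 / 2) * s : ℝ) =
      Complex.I * (∑ n ∈ Finset.Icc 1 N, x n • Complex.exp (s * x n * Complex.I) -
        s * Complex.I * ∑ n ∈ Finset.Icc 1 N, Complex.exp (s * x n * Complex.I)) *
        (Real.exp (s ^ 2 / 2) : ℝ) := by
    rw [Complex.ofReal_mul]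
    linear_combination (-(s * (∑ n ∈ Finset.Icc 1 N, Complex.exp (s * x n * Complex.I)) *
        (Real.exp (s ^ 2 / 2) : ℝ)) : ℂ) * (-Complex.I_mul_I)
  rw [hfactor, norm_mul, norm_mul, Complex.norm_I, one_mul,
    Complex.norm_of_nonneg (Real.exp_pos _).le]
  have hsq : s ^ 2 ≤ t ^ 2 := sq_le_sq.2 hs'
  gcongr
  refine (hsol.norm_stein_exp_le hN hdec hmean s).trans ?_
  gcongr

theorem IsSolution.norm_average_exp_sub_le (hsol : IsSolution N x) (hN : 1 ≤ N)
    (hdec : ∀ n, 1 ≤ n → n < N → x (n + 1) < x n)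
    (hmean : ∑ i ∈ Finset.Icc 1 N, x i = 0) (t : ℝ) :
    ‖(1 / (N : ℝ)) • (∑ n ∈ Finset.Icc 1 N, Complex.exp (t * x n * Complex.I)) -
        (Real.exp (-(t ^ 2 / 2)) : ℝ)‖ ≤
      4 * |t| ^ 3 * (1 / √N) + t ^ 2 * (1 / N) := by
  have hNpos : (0 : ℝ) < N := by exact_mod_cast hN
  have hNC : (N : ℂ) ≠ 0 := by exact_mod_cast hNpos.ne'
  have hE : ((Real.exp (t ^ 2 / 2) : ℝ) : ℂ) * (Real.exp (-(t ^ 2 / 2)) : ℝ) = 1 := by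
    rw [← Complex.ofReal_mul, ← Real.exp_add]
    simp
  have hER : Real.exp (t ^ 2 / 2) * Real.exp (-(t ^ 2 / 2)) = 1 := by
    rw [← Real.exp_add]
    simp
  have hfactor : (1 / (N : ℝ)) • (∑ n ∈ Finset.Icc 1 N, Complex.exp (t * x n * Complex.I)) -
        (Real.exp (-(t ^ 2 / 2)) : ℝ) =
      ((∑ n ∈ Finset.Icc 1 N, Complex.exp (t * x n * Complex.I)) * Real.exp (t ^ 2 / 2) - N) *
        ((Real.exp (-(t ^ 2 / 2)) * (1 / N) : ℝ) : ℂ) := by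
    have hN1 : (N : ℂ) * ((1 / N : ℝ) : ℂ) = 1 := by
      push_cast
      exact mul_one_div_cancel hNC
    rw [Complex.real_smul, Complex.ofReal_mul]
    linear_combination (Real.exp (-(t ^ 2 / 2)) : ℝ) * hN1 -
      ((1 / N : ℝ) : ℂ) * (∑ n ∈ Finset.Icc 1 N, Complex.exp (t * x n * Complex.I)) * hE
  rw [hfactor, norm_mul, Complex.norm_of_nonneg (by positivity)]
  calc _ ≤ (4 * t ^ 2 * √N + |t|) * Real.exp (t ^ 2 / 2) * |t| *
        (Real.exp (-(t ^ 2 / 2)) * (1 / N)) := by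
        gcongr
        exact hsol.norm_sum_exp_mul_sub_le hN hdec hmean t
    _ = (4 * t ^ 2 * √N + |t|) * |t| * (1 / N) *
        (Real.exp (t ^ 2 / 2) * Real.exp (-(t ^ 2 / 2))) := by ring
    _ = _ := by
        have hs : √(N : ℝ) * (1 / N) = 1 / √N := by
          rw [mul_one_div, Real.sqrt_div_self']
        rw [hER, ← sq_abs t, ← hs]
        ring

end ZeroMeanSolution

/-- The empirical distribution of `y 1, …, y N`. -/
noncomputable def empiricalMeasure (N : ℕ) (y : ℕ → ℝ) : Measure ℝ :=
  (N : ℝ≥0∞)⁻¹ • ∑ n ∈ Finset.Icc 1 N, Measure.dirac (y n)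

instance (N : ℕ) [NeZero N] (y : ℕ → ℝ) : IsProbabilityMeasure (empiricalMeasure N y) where
  measure_univ := by
    simp [empiricalMeasure, ENNReal.inv_mul_cancel, NeZero.ne N]

theorem integral_empiricalMeasure {E : Type*} [NormedAddCommGroup E] [NormedSpace ℝ E]
    [CompleteSpace E] (N : ℕ) (y : ℕ → ℝ) (f : ℝ → E) :
    ∫ t, f t ∂(empiricalMeasure N y) = (1 / (N : ℝ)) • ∑ n ∈ Finset.Icc 1 N, f (y n) := by
  rw [empiricalMeasure, integral_smul_measure, integral_finsetSum_measure]
  · simp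
  · exact fun n _ => integrable_dirac (by simp)

/-- For each `N ≥ 3`, let `x N` be the unique strictly decreasing zero-mean solution of the
recursion. Then the empirical distributions `𝕡_N = (1/N) ∑_{n=1}^N δ_{x_{N,n}}` converge
weakly to the standard Gaussian distribution `N(0,1)`: for every bounded continuous
`f : ℝ → ℝ`, the empirical averages of `f` converge to `∫ f dN(0,1)`. -/
theorem empirical_distribution_tendsto_gaussian (x : ℕ → ℕ → ℝ)
    (hsol : ∀ N, 3 ≤ N → IsSolution N (x N))
    (hdec : ∀ N, 3 ≤ N → ∀ n, 1 ≤ n → n < N → x N (n + 1) < x N n)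
    (hmean : ∀ N, 3 ≤ N → ∑ i ∈ Finset.Icc 1 N, x N i = 0) :
    ∀ f : BoundedContinuousFunction ℝ ℝ,
      Tendsto (fun N : ℕ => (1 / (N : ℝ)) * ∑ n ∈ Finset.Icc 1 N, f (x N n))
        atTop (nhds (∫ t, f t ∂(gaussianReal 0 1))) := by
  intro f
  have hlim : Tendsto (β := ProbabilityMeasure ℝ) (fun k : ℕ =>
      (⟨empiricalMeasure (k + 3) (x (k + 3)), inferInstance⟩ : ProbabilityMeasure ℝ)) atTop
      (nhds (X := ProbabilityMeasure ℝ) ⟨gaussianReal 0 1, inferInstance⟩) := by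
    refine ProbabilityMeasure.tendsto_iff_tendsto_charFun.2 fun t => ?_
    rw [tendsto_iff_norm_sub_tendsto_zero]
    have hbound : Tendsto (fun N : ℕ => 4 * |t| ^ 3 * (1 / √(N : ℝ)) + t ^ 2 * (1 / (N : ℝ)))
        atTop (nhds 0) := by
      have h1 : Tendsto (fun N : ℕ => 1 / √(N : ℝ)) atTop (nhds 0) := by
        simpa only [one_div, Function.comp_def] using tendsto_inv_atTop_zero.comp
          (Real.tendsto_sqrt_atTop.comp tendsto_natCast_atTop_atTop)
      simpa using (h1.const_mul (4 * |t| ^ 3)).add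
        (tendsto_one_div_atTop_nhds_zero_nat.const_mul (t ^ 2))
    refine squeeze_zero (fun _ => norm_nonneg _) (fun k => ?_)
      (hbound.comp (tendsto_add_atTop_nat 3))
    have hk : 3 ≤ k + 3 := by omega
    have h := (hsol (k + 3) hk).norm_average_exp_sub_le (by omega) (hdec _ hk) (hmean _ hk) t
    simp only [ProbabilityMeasure.coe_mk]
    rw [charFun_gaussianReal, charFun_apply_real, integral_empiricalMeasure]
    convert! h using 3
    push_cast
    congr 1
    simp
  have h := ProbabilityMeasure.tendsto_iff_forall_integral_tendsto.1 hlim f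
  simp only [ProbabilityMeasure.coe_mk, integral_empiricalMeasure, smul_eq_mul] at h
  exact (tendsto_add_atTop_iff_nat 3).1 h
end

section
/- As N → ∞, the densities y_N converge uniformly on ℝ to the standard normal density: sup_{x ∈ ℝ} |y_N(x) − (2π)^{−1/2} e^{−x²/2}| → 0. -/
open Finset

/-- The piecewise-constant density `y_N`: it equals `S_{N,n}/(N-1)`
(equivalently `1/((N-1)(x_{N,n} - x_{N,n+1}))`) on `[x_{N,n+1}, x_{N,n})` for
`n = 1, ..., N-1`, and `0` outside `[x_{N,N}, x_{N,1})`. -/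
noncomputable def yDen (N : ℕ) (x : ℕ → ℝ) (t : ℝ) : ℝ :=
  ∑ n ∈ Finset.Icc 1 (N - 1), if x (n + 1) ≤ t ∧ t < x n then S x n / ((N : ℝ) - 1) else 0

open MeasureTheory Filter

lemma S_zero (x : ℕ → ℝ) : S x 0 = 0 := by simp [S]

lemma S_one (x : ℕ → ℝ) : S x 1 = x 1 := by simp [S]

lemma S_succ (x : ℕ → ℝ) (n : ℕ) : S x (n + 1) = S x n + x (n + 1) :=
  Finset.sum_Icc_succ_top (by omega) x

/-- A zero-mean solution of the recursion with positive partial sums. -/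
structure IsGround (N : ℕ) (x : ℕ → ℝ) : Prop where
  pos : ∀ n, 1 ≤ n → n < N → 0 < S x n
  step : ∀ n, 1 ≤ n → n < N → x (n + 1) = x n - 1 / S x n
  mean : S x N = 0

lemma IsSolution.isGround {N : ℕ} {x : ℕ → ℝ} (h : IsSolution N x)
    (hdec : ∀ n, 1 ≤ n → n < N → x (n + 1) < x n) (hmean : S x N = 0) : IsGround N x := by
  refine ⟨fun n h1 h2 => ?_, fun n h1 h2 => (h n h1 (by omega)).2, hmean⟩
  have := hdec n h1 h2
  rw [(h n h1 (by omega)).2] at this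
  exact one_div_pos.1 (by linarith)

/-- Solutions are ordered by their initial values. -/
lemma S_lt_S_of_lt {N : ℕ} {x z : ℕ → ℝ} (hx : IsGround N x) (hz : IsGround N z)
    (h : x 1 < z 1) : ∀ n, 1 ≤ n → n ≤ N → x n < z n ∧ S x n < S z n := by
  intro n hn
  induction n, hn using Nat.le_induction with
  | base => intro _; simpa [S] using h
  | succ n hn ih =>
    intro hN
    obtain ⟨h1, h2⟩ := ih (by omega)
    have h3 : x (n + 1) < z (n + 1) := by
      rw [hx.step n hn hN, hz.step n hn hN]
      have := one_div_lt_one_div_of_lt (hx.pos n hn hN) h2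
      linarith
    exact ⟨h3, by rw [S_succ, S_succ]; linarith⟩

lemma IsGround.eq_of_first_eq {N : ℕ} {x z : ℕ → ℝ} (hx : IsGround N x) (hz : IsGround N z)
    (h : x 1 = z 1) : ∀ n, 1 ≤ n → n ≤ N → x n = z n ∧ S x n = S z n := by
  intro n hn
  induction n, hn using Nat.le_induction with
  | base => intro _; simpa [S] using h
  | succ n hn ih =>
    intro hN
    obtain ⟨h1, h2⟩ := ih (by omega)
    have h3 : x (n + 1) = z (n + 1) := by
      rw [hx.step n hn hN, hz.step n hn hN, h1, h2]
    exact ⟨h3, by rw [S_succ, S_succ, h2, h3]⟩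

lemma IsGround.unique {N : ℕ} (hN : 1 ≤ N) {x z : ℕ → ℝ} (hx : IsGround N x)
    (hz : IsGround N z) (n : ℕ) (h1 : 1 ≤ n) (hn : n ≤ N) : x n = z n ∧ S x n = S z n := by
  refine hx.eq_of_first_eq hz ?_ n h1 hn
  rcases lt_trichotomy (x 1) (z 1) with h | h | h
  · have := (S_lt_S_of_lt hx hz h N hN le_rfl).2
    rw [hx.mean, hz.mean] at this
    exact absurd this (lt_irrefl _)
  · exact h
  · have := (S_lt_S_of_lt hz hx h N hN le_rfl).2
    rw [hx.mean, hz.mean] at this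
    exact absurd this (lt_irrefl _)

lemma IsGround.S_reflect {N : ℕ} {x : ℕ → ℝ} (hx : IsGround N x) (n : ℕ) (hn : n ≤ N) :
    S (fun i => - x (N + 1 - i)) n = S x (N - n) := by
  induction n with
  | zero => simp [S_zero, hx.mean]
  | succ n ih =>
    rw [S_succ, ih (by omega), show N - n = (N - (n + 1)) + 1 by omega, S_succ,
      show N + 1 - (n + 1) = N - (n + 1) + 1 by omega]
    ring

lemma IsGround.reflect {N : ℕ} {x : ℕ → ℝ} (hx : IsGround N x) :
    IsGround N (fun i => - x (N + 1 - i)) := by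
  refine ⟨fun n h1 h2 => ?_, fun n h1 h2 => ?_, ?_⟩
  · rw [hx.S_reflect n h2.le]
    exact hx.pos _ (by omega) (by omega)
  · rw [hx.S_reflect n h2.le]
    have := hx.step (N - n) (by omega) (by omega)
    rw [show N - n + 1 = N + 1 - n by omega] at this
    simp only [this, show N + 1 - (n + 1) = N - n by omega]
    ring
  · rw [hx.S_reflect N le_rfl]
    simp [S_zero]

lemma IsGround.x_symm {N : ℕ} {x : ℕ → ℝ} (hx : IsGround N x) (n : ℕ) (h1 : 1 ≤ n)
    (hn : n ≤ N) : x (N + 1 - n) = - x n := by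
  have := (hx.unique (by omega) hx.reflect n h1 hn).1
  linarith

lemma IsGround.S_symm {N : ℕ} {x : ℕ → ℝ} (hx : IsGround N x) (n : ℕ) (h1 : 1 ≤ n)
    (hn : n ≤ N) : S x (N - n) = S x n := by
  rw [(hx.unique (by omega) hx.reflect n h1 hn).2, hx.S_reflect n hn]

lemma IsGround.lt_succ {N : ℕ} {x : ℕ → ℝ} (hx : IsGround N x) (n : ℕ) (h1 : 1 ≤ n)
    (hn : n < N) : x (n + 1) < x n := by
  rw [hx.step n h1 hn]
  have := one_div_pos.2 (hx.pos n h1 hn)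
  linarith

lemma IsGround.anti {N : ℕ} {x : ℕ → ℝ} (hx : IsGround N x) {i j : ℕ} (hi : 1 ≤ i)
    (hij : i ≤ j) (hj : j ≤ N) : x j ≤ x i := by
  induction j, hij using Nat.le_induction with
  | base => exact le_rfl
  | succ j hij ih => exact (hx.lt_succ j (by omega) (by omega)).le.trans (ih (by omega))

lemma IsGround.nonneg {N : ℕ} {x : ℕ → ℝ} (hx : IsGround N x) (n : ℕ) (h1 : 1 ≤ n)
    (hn : 2 * n ≤ N + 1) : 0 ≤ x n := by
  have h := hx.anti h1 (show n ≤ N + 1 - n by omega) (by omega)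
  rw [hx.x_symm n h1 (by omega)] at h
  linarith

lemma IsGround.mul_le_S {N : ℕ} {x : ℕ → ℝ} (hx : IsGround N x) (n : ℕ)
    (hn : n ≤ N) : n * x n ≤ S x n := by
  have h : ∑ i ∈ Finset.Icc 1 n, x n ≤ ∑ i ∈ Finset.Icc 1 n, x i := by
    refine Finset.sum_le_sum fun i hi => ?_
    rw [Finset.mem_Icc] at hi
    exact hx.anti hi.1 hi.2 hn
  simpa [S] using h

lemma IsGround.S_le_mul {N : ℕ} {x : ℕ → ℝ} (hx : IsGround N x) (n : ℕ)
    (hn : n ≤ N) : S x n ≤ n * x 1 := by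
  have h : ∑ i ∈ Finset.Icc 1 n, x i ≤ ∑ i ∈ Finset.Icc 1 n, x 1 := by
    refine Finset.sum_le_sum fun i hi => ?_
    rw [Finset.mem_Icc] at hi
    exact hx.anti le_rfl hi.1 (by omega)
  simpa [S] using h

lemma IsGround.S_mono {N : ℕ} {x : ℕ → ℝ} (hx : IsGround N x) {i j : ℕ}
    (hij : i ≤ j) (hj : 2 * j ≤ N + 1) : S x i ≤ S x j := by
  induction j, hij using Nat.le_induction with
  | base => exact le_rfl
  | succ j hij ih =>
    rw [S_succ]
    have := hx.nonneg (j + 1) (by omega) hj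
    linarith [ih (by omega)]

lemma IsGround.S_le_mid {N : ℕ} {x : ℕ → ℝ} (hx : IsGround N x) (n : ℕ) (h1 : 1 ≤ n)
    (hn : n ≤ N) : S x n ≤ S x ((N + 1) / 2) := by
  rcases le_or_gt n ((N + 1) / 2) with h | h
  · exact hx.S_mono h (by omega)
  · rw [← hx.S_symm n h1 hn]
    exact hx.S_mono (by omega) (by omega)

lemma IsGround.sum_sq {N : ℕ} {x : ℕ → ℝ} (hx : IsGround N x) (n : ℕ) (h1 : 1 ≤ n)
    (hn : n ≤ N) : ∑ i ∈ Finset.Icc 1 n, x i ^ 2 = x n * S x n + (n - 1) := by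
  induction n, h1 using Nat.le_induction with
  | base => simp [S]; ring
  | succ n h1 ih =>
    rw [Finset.sum_Icc_succ_top (by omega), ih (by omega), S_succ]
    have hp := hx.pos n h1 hn
    have : S x n * (x n - x (n + 1)) = 1 := by
      rw [hx.step n h1 hn]; field_simp; ring
    push_cast
    linear_combination this

lemma IsGround.first_sq_le {N : ℕ} (hN : 1 ≤ N) {x : ℕ → ℝ} (hx : IsGround N x) :
    x 1 ^ 2 ≤ N - 1 := by
  have h := hx.sum_sq N hN le_rfl
  rw [hx.mean, mul_zero, zero_add] at h
  rw [← h]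
  exact Finset.single_le_sum (f := fun i => x i ^ 2) (fun i _ => sq_nonneg _)
    (Finset.mem_Icc.2 ⟨le_rfl, hN⟩)

/-- The maximal partial sum is at least of order `√N`. -/
lemma IsGround.le_mid_sq {N : ℕ} (hN : 2 ≤ N) {x : ℕ → ℝ} (hx : IsGround N x) :
    (N : ℝ) - 1 ≤ 2 * S x ((N + 1) / 2) ^ 2 := by
  set M := S x ((N + 1) / 2)
  have key : ∀ n, 1 ≤ n → n ≤ N → (n : ℝ) - 1 ≤ M * (x 1 - x n) := by
    intro n h1
    induction n, h1 using Nat.le_induction with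
    | base => intro _; simp
    | succ n h1 ih =>
      intro hn
      have hp := hx.pos n h1 hn
      have h2 : S x n * (x n - x (n + 1)) = 1 := by
        rw [hx.step n h1 hn]; field_simp; ring
      have h3 := mul_le_mul_of_nonneg_right (hx.S_le_mid n h1 (by omega))
        (sub_nonneg.2 (hx.lt_succ n h1 hn).le)
      have := ih (by omega)
      push_cast
      linarith
  have h := key N (by omega) le_rfl
  have h1 := hx.x_symm 1 le_rfl (by omega)
  simp only [Nat.add_sub_cancel] at h1
  have h2 : x 1 ≤ M := S_one x ▸ hx.S_le_mid 1 le_rfl (by omega)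
  have hM : 0 < M := hx.pos _ (by omega) (by omega)
  rw [h1] at h
  nlinarith

lemma energy_step_le {s a b : ℝ} (hs : 0 < s) (hb : 0 ≤ b) (hab : b = a - 1 / s) :
    Real.log (s + b) + b ^ 2 / 2 ≤ Real.log s + a ^ 2 / 2 := by
  have ha : a = b + 1 / s := by linarith
  have h0 : 0 ≤ b / s := by positivity
  have h1 : Real.log (s + b) = Real.log s + Real.log (1 + b / s) := by
    rw [← Real.log_mul hs.ne' (by positivity)]
    congr 1
    field_simp
  have h2 : Real.log (1 + b / s) ≤ b / s := by
    linarith [Real.log_le_sub_one_of_pos (show 0 < 1 + b / s by positivity)]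
  have h3 : a ^ 2 / 2 = b ^ 2 / 2 + b / s + (1 / s) ^ 2 / 2 := by rw [ha]; ring
  nlinarith [sq_nonneg (1 / s)]

lemma le_energy_step {s a b : ℝ} (hs : 0 < s) (hb : 0 ≤ b) (hab : b = a - 1 / s) :
    Real.log s + a ^ 2 / 2 - a / (2 * s) - (b / s) ^ 2 / 2 ≤
      Real.log (s + b) + b ^ 2 / 2 - b / (2 * (s + b)) := by
  have ha : a = b + 1 / s := by linarith
  have h0 : 0 ≤ b / s := by positivity
  have h1 : Real.log (s + b) = Real.log s + Real.log (1 + b / s) := by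
    rw [← Real.log_mul hs.ne' (by positivity)]
    congr 1
    field_simp
  have h2 : b / s - (b / s) ^ 2 / 2 ≤ Real.log (1 + b / s) := by
    refine le_trans ?_ (Real.le_log_one_add_of_nonneg h0)
    rw [le_div_iff₀ (by positivity)]
    nlinarith [pow_nonneg h0 3]
  have h3 : a ^ 2 / 2 - a / (2 * s) = b ^ 2 / 2 + b / (2 * s) := by
    rw [ha]; field_simp; ring
  have h4 : b / (2 * (s + b)) ≤ b / (2 * s) := by gcongr; linarith
  have h5 : b / s = b / (2 * s) + b / (2 * s) := by field_simp; ring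
  linarith

lemma IsGround.energy_anti {N : ℕ} {x : ℕ → ℝ} (hx : IsGround N x) {i j : ℕ} (hi : 1 ≤ i)
    (hij : i ≤ j) (hj : 2 * j ≤ N + 1) :
    Real.log (S x j) + x j ^ 2 / 2 ≤ Real.log (S x i) + x i ^ 2 / 2 := by
  induction j, hij using Nat.le_induction with
  | base => exact le_rfl
  | succ j hij ih =>
    refine le_trans ?_ (ih (by omega))
    rw [S_succ]
    exact energy_step_le (hx.pos j (by omega) (by omega)) (hx.nonneg _ (by omega) hj)
      (hx.step j (by omega) (by omega))

lemma IsGround.energy_corrected_mono {N : ℕ} {x : ℕ → ℝ} (hx : IsGround N x) {i j : ℕ}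
    (hi : 2 ≤ i) (hij : i ≤ j) (hj : 2 * j ≤ N + 1) :
    Real.log (S x i) + x i ^ 2 / 2 - x i / (2 * S x i) - 1 / (2 * ((i : ℝ) - 1)) ≤
      Real.log (S x j) + x j ^ 2 / 2 - x j / (2 * S x j) - 1 / (2 * ((j : ℝ) - 1)) := by
  induction j, hij using Nat.le_induction with
  | base => exact le_rfl
  | succ j hij ih =>
    refine (ih (by omega)).trans ?_
    have hp := hx.pos j (by omega) (by omega)
    have hb := hx.nonneg _ (show 1 ≤ j + 1 by omega) hj
    have h := le_energy_step hp hb (hx.step j (by omega) (by omega))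
    rw [← S_succ] at h
    have hj2 : (2 : ℝ) ≤ j := by exact_mod_cast (show 2 ≤ j by omega)
    have h1 : x (j + 1) / S x j ≤ 1 / j := by
      rw [div_le_div_iff₀ hp (by linarith)]
      have := hx.mul_le_S j (by omega)
      nlinarith [hx.lt_succ j (by omega) (by omega)]
    have h2 : (x (j + 1) / S x j) ^ 2 ≤ (1 / (j : ℝ)) ^ 2 := by
      have : 0 ≤ x (j + 1) / S x j := by positivity
      gcongr
    have h3 : (1 / (j : ℝ)) ^ 2 ≤ 1 / ((j : ℝ) - 1) - 1 / j := by
      rw [div_pow, div_sub_div _ _ (by linarith) (by linarith),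
        div_le_div_iff₀ (by nlinarith) (by nlinarith)]
      nlinarith
    have h4 : 1 / (2 * ((j : ℝ) - 1)) - 1 / (2 * (j : ℝ)) =
        (1 / ((j : ℝ) - 1) - 1 / j) / 2 := by
      have : (j : ℝ) - 1 ≠ 0 := by linarith
      field_simp
    push_cast
    rw [add_sub_cancel_right]
    linarith

lemma IsGround.mid_le {N : ℕ} (hN : 2 ≤ N) {x : ℕ → ℝ} (hx : IsGround N x) :
    x ((N + 1) / 2) ≤ 1 / S x ((N + 1) / 2) := by
  have h1 := hx.step ((N + 1) / 2) (by omega) (by omega)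
  have h2 := hx.nonneg (N - (N + 1) / 2) (by omega) (by omega)
  have h3 := hx.x_symm (N - (N + 1) / 2) (by omega) (by omega)
  rw [show N + 1 - (N - (N + 1) / 2) = (N + 1) / 2 + 1 by omega] at h3
  linarith

/-- In the right half of the bulk, `log S_n + t ^ 2 / 2` is nearly constant. -/
lemma IsGround.energy_right {N K : ℕ} {x : ℕ → ℝ} (hx : IsGround N x) (hK : 2 ≤ K)
    (hKN : (K : ℝ) ^ 4 ≤ N - 1) {n : ℕ} (hKn : K ≤ n) (hn : 2 * n ≤ N + 1) {t : ℝ}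
    (ht1 : x (n + 1) ≤ t) (ht2 : t ≤ x n) :
    |Real.log (S x n) + t ^ 2 / 2 - Real.log (S x ((N + 1) / 2))| ≤ 4 / ((K : ℝ) - 1) := by
  have hN : 2 ≤ N := by omega
  have hK2 : (2 : ℝ) ≤ K := by exact_mod_cast hK
  have hKn' : (K : ℝ) ≤ n := by exact_mod_cast hKn
  have hM := hx.le_mid_sq hN
  have hxm := hx.mid_le hN
  have hxm0 := hx.nonneg ((N + 1) / 2) (by omega) (by omega)
  have hMp := hx.pos ((N + 1) / 2) (by omega) (by omega)
  have hp := hx.pos n (by omega) (by omega)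
  have hE1 := hx.energy_anti (show 1 ≤ n by omega) (show n ≤ (N + 1) / 2 by omega) (by omega)
  have hE2 := hx.energy_corrected_mono (show 2 ≤ n by omega) (show n ≤ (N + 1) / 2 by omega)
    (by omega)
  have hstep := hx.step n (by omega) (by omega)
  have hxn := hx.nonneg n (by omega) hn
  have hnS := hx.mul_le_S n (by omega)
  have hm2 : (2 : ℝ) ≤ ((N + 1) / 2 : ℕ) := by exact_mod_cast (show 2 ≤ (N + 1) / 2 by omega)
  have hcase : n = (N + 1) / 2 ∨ 2 * (n + 1) ≤ N + 1 := by omega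
  have hpos' := fun h => hx.nonneg (n + 1) (by omega) h
  set m := (N + 1) / 2
  set M := S x m
  have hMinv : (1 / M) ^ 2 ≤ 1 / ((K : ℝ) - 1) := by
    rw [div_pow, one_pow, div_le_div_iff₀ (by positivity) (by linarith)]
    nlinarith [pow_le_pow_left₀ (by norm_num) hK2 3, pow_pos (show (0 : ℝ) < K by linarith) 3]
  have hd : 0 < 1 / ((K : ℝ) - 1) := one_div_pos.2 (by linarith)
  have h4 : 4 / ((K : ℝ) - 1) = 4 * (1 / ((K : ℝ) - 1)) := by ring
  rw [h4]
  set d := 1 / ((K : ℝ) - 1)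
  have hnd : 1 / (n : ℝ) ≤ d := one_div_le_one_div_of_le (by linarith) (by linarith)
  have hnd' : 1 / (2 * ((n : ℝ) - 1)) ≤ d := one_div_le_one_div_of_le (by linarith) (by linarith)
  rcases hcase with h | h
  · have ht : |t| ≤ 1 / M := by
      subst h
      exact abs_le.2 ⟨by linarith, by linarith⟩
    have ht2 : t ^ 2 ≤ (1 / M) ^ 2 := by
      rw [← sq_abs]
      gcongr
    rw [h, add_sub_cancel_left, abs_of_nonneg (by positivity)]
    linarith
  · have hy := hpos' h
    have hS : x n / S x n ≤ 1 / n := by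
      rw [div_le_div_iff₀ hp (by linarith)]
      linarith
    have hxm2 : x m ^ 2 ≤ (1 / M) ^ 2 := by gcongr
    have ht3 : t ^ 2 ≤ x n ^ 2 := by
      have : 0 ≤ t := hy.trans ht1
      gcongr
    have ht4 : x (n + 1) ^ 2 ≤ t ^ 2 := by gcongr
    have hs1 : 0 < 1 / S x n := one_div_pos.2 hp
    have ht5 : x n ^ 2 - x (n + 1) ^ 2 ≤ 2 * (x n / S x n) := by
      have e : x n ^ 2 - x (n + 1) ^ 2 = 1 / S x n * (x n + x (n + 1)) := by
        linear_combination (- x n - x (n + 1)) * hstep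
      rw [e, show 2 * (x n / S x n) = 1 / S x n * (x n + x n) by ring]
      gcongr
      linarith
    have h6 : 0 ≤ x m / (2 * M) := by positivity
    have h7 : 0 ≤ 1 / (2 * ((m : ℝ) - 1)) := one_div_nonneg.2 (by linarith)
    have h8 : x n / (2 * S x n) = (x n / S x n) / 2 := by ring
    have h9 := sq_nonneg (x m)
    rw [abs_le]
    constructor <;> linarith

lemma IsGround.energy_bulk {N K : ℕ} {x : ℕ → ℝ} (hx : IsGround N x) (hK : 2 ≤ K)
    (hKN : (K : ℝ) ^ 4 ≤ N - 1) {n : ℕ} (hKn : K ≤ n) (hn : n + K ≤ N) {t : ℝ}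
    (ht1 : x (n + 1) ≤ t) (ht2 : t ≤ x n) :
    |Real.log (S x n) + t ^ 2 / 2 - Real.log (S x ((N + 1) / 2))| ≤ 4 / ((K : ℝ) - 1) := by
  rcases le_or_gt (2 * n) (N + 1) with h | h
  · exact hx.energy_right hK hKN hKn h ht1 ht2
  · rw [← hx.S_symm n (by omega) (by omega), ← neg_sq t]
    have h1 := hx.x_symm n (by omega) (by omega)
    have h2 := hx.x_symm (n + 1) (by omega) (by omega)
    rw [show N + 1 - n = N - n + 1 by omega] at h1
    rw [show N + 1 - (n + 1) = N - n by omega] at h2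
    exact hx.energy_right hK hKN (by omega) (by omega) (by linarith) (by linarith)

/-- Two-sided Gaussian bounds for the density in the bulk. -/
lemma IsGround.density_bulk {N K : ℕ} {x : ℕ → ℝ} (hx : IsGround N x) (hK : 2 ≤ K)
    (hKN : (K : ℝ) ^ 4 ≤ N - 1) {n : ℕ} (hKn : K ≤ n) (hn : n + K ≤ N) {t : ℝ}
    (ht1 : x (n + 1) ≤ t) (ht2 : t ≤ x n) :
    S x ((N + 1) / 2) / ((N : ℝ) - 1) * Real.exp (-(4 / ((K : ℝ) - 1))) * Real.exp (-t ^ 2 / 2)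
        ≤ S x n / ((N : ℝ) - 1) ∧
      S x n / ((N : ℝ) - 1) ≤
        S x ((N + 1) / 2) / ((N : ℝ) - 1) * Real.exp (4 / ((K : ℝ) - 1)) *
          Real.exp (-t ^ 2 / 2) := by
  have h := abs_le.1 (hx.energy_bulk hK hKN hKn hn ht1 ht2)
  have hMp := hx.pos ((N + 1) / 2) (by omega) (by omega)
  have hp := hx.pos n (by omega) (by omega)
  have hN : 0 < (N : ℝ) - 1 := by
    have : 0 < (K : ℝ) ^ 4 := by positivity
    linarith
  set M := S x ((N + 1) / 2)
  have e : ∀ d : ℝ, M / ((N : ℝ) - 1) * Real.exp d * Real.exp (-t ^ 2 / 2) =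
      Real.exp (Real.log M + d + -t ^ 2 / 2) / ((N : ℝ) - 1) := by
    intro d
    rw [Real.exp_add, Real.exp_add, Real.exp_log hMp]
    ring
  rw [e, e]
  constructor
  · gcongr
    rw [← Real.le_log_iff_exp_le hp]
    linarith
  · gcongr
    rw [← Real.log_le_iff_le_exp hp]
    linarith

lemma IsGround.density_tail {N K : ℕ} {x : ℕ → ℝ} (hx : IsGround N x) (hK : 2 ≤ K)
    (hKN : (K : ℝ) ^ 4 ≤ N - 1) {n : ℕ} (h1 : 1 ≤ n) (hn : n < N) (h : n ≤ K ∨ N ≤ n + K) :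
    S x n / ((N : ℝ) - 1) ≤ 1 / K := by
  wlog hnK : n ≤ K generalizing n
  · rw [← hx.S_symm n h1 hn.le]
    exact this (by omega) (by omega) (by omega) (by omega)
  have hK2 : (2 : ℝ) ≤ K := by exact_mod_cast hK
  have hKp : 0 < (K : ℝ) ^ 4 := by positivity
  have h3 := hx.first_sq_le (by omega)
  have h4 := hx.S_le_mul n (by omega)
  have h0 : 0 < x 1 := S_one x ▸ hx.pos 1 le_rfl (by omega)
  have h5 : (n : ℝ) * x 1 ≤ K * x 1 := by gcongr
  have h6 : (K : ℝ) ^ 2 * x 1 ≤ N - 1 := by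
    apply le_of_sq_le_sq _ (by linarith)
    calc ((K : ℝ) ^ 2 * x 1) ^ 2 = (K : ℝ) ^ 4 * x 1 ^ 2 := by ring
      _ ≤ ((N : ℝ) - 1) * (N - 1) := by gcongr; linarith
      _ = _ := by ring
  rw [div_le_div_iff₀ (by linarith) (by linarith)]
  nlinarith

lemma IsGround.yDen_eq {N : ℕ} {x : ℕ → ℝ} (hx : IsGround N x) {n : ℕ} (h1 : 1 ≤ n)
    (hn : n < N) {t : ℝ} (ht1 : x (n + 1) ≤ t) (ht2 : t < x n) :
    yDen N x t = S x n / ((N : ℝ) - 1) := by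
  unfold yDen
  rw [Finset.sum_eq_single_of_mem n (Finset.mem_Icc.2 ⟨h1, by omega⟩), if_pos ⟨ht1, ht2⟩]
  intro j hj hjn
  rw [Finset.mem_Icc] at hj
  refine if_neg fun ⟨h2, h3⟩ => ?_
  rcases lt_or_gt_of_ne hjn with h | h
  · have := hx.anti (show 1 ≤ j + 1 by omega) (show j + 1 ≤ n by omega) (by omega)
    linarith
  · have := hx.anti (show 1 ≤ n + 1 by omega) (show n + 1 ≤ j by omega) (by omega)
    linarith

/-- Locating a point in the partition given by a finite sequence. -/
lemma exists_mem_step (x : ℕ → ℝ) {a b : ℕ} (hab : a ≤ b) {t : ℝ} (h1 : x b ≤ t)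
    (h2 : t < x a) : ∃ n, a ≤ n ∧ n < b ∧ x (n + 1) ≤ t ∧ t < x n := by
  induction b, hab using Nat.le_induction with
  | base => linarith
  | succ b hab ih =>
    rcases le_or_gt (x b) t with h | h
    · obtain ⟨n, h3, h4, h5⟩ := ih h
      exact ⟨n, h3, by omega, h5⟩
    · exact ⟨b, hab, by omega, h1, h⟩

lemma IsGround.yDen_bulk {N K : ℕ} {x : ℕ → ℝ} (hx : IsGround N x) (hK : 2 ≤ K)
    (hKN : (K : ℝ) ^ 4 ≤ N - 1) (h2K : 2 * K ≤ N) {t : ℝ} (ht1 : - x K ≤ t) (ht2 : t < x K) :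
    S x ((N + 1) / 2) / ((N : ℝ) - 1) * Real.exp (-(4 / ((K : ℝ) - 1))) * Real.exp (-t ^ 2 / 2)
        ≤ yDen N x t ∧
      yDen N x t ≤ S x ((N + 1) / 2) / ((N : ℝ) - 1) * Real.exp (4 / ((K : ℝ) - 1)) *
          Real.exp (-t ^ 2 / 2) := by
  rw [← hx.x_symm K (by omega) (by omega)] at ht1
  obtain ⟨n, h1, h2, h3, h4⟩ := exists_mem_step x (by omega) ht1 ht2
  rw [hx.yDen_eq (by omega) (by omega) h3 h4]
  exact hx.density_bulk hK hKN h1 (by omega) h3 h4.le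

lemma IsGround.yDen_tail {N K : ℕ} {x : ℕ → ℝ} (hx : IsGround N x) (hK : 2 ≤ K)
    (hKN : (K : ℝ) ^ 4 ≤ N - 1) (h2K : 2 * K ≤ N) {t : ℝ} (ht : t < - x K ∨ x K ≤ t) :
    0 ≤ yDen N x t ∧ yDen N x t ≤ 1 / K := by
  by_cases h : x N ≤ t ∧ t < x 1
  · obtain ⟨n, h1, h2, h3, h4⟩ := exists_mem_step x (by omega) h.1 h.2
    rw [hx.yDen_eq h1 h2 h3 h4]
    have hN : (1 : ℝ) < N := by exact_mod_cast (show 1 < N by omega)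
    refine ⟨div_nonneg (hx.pos n h1 h2).le (by linarith),
      hx.density_tail hK hKN h1 h2 ?_⟩
    by_contra! hc
    rcases ht with ht | ht
    · rw [← hx.x_symm K (by omega) (by omega)] at ht
      have := hx.anti (show 1 ≤ n + 1 by omega) (show n + 1 ≤ N + 1 - K by omega) (by omega)
      linarith
    · have := hx.anti (show 1 ≤ K by omega) hc.1.le (by omega)
      linarith
  · have : yDen N x t = 0 := by
      refine Finset.sum_eq_zero fun n hn => if_neg fun ⟨h1, h2⟩ => h ?_
      rw [Finset.mem_Icc] at hn
      exact ⟨(hx.anti (by omega) (show n + 1 ≤ N by omega) le_rfl).trans h1,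
        h2.trans_le (hx.anti le_rfl hn.1 (by omega))⟩
    rw [this]
    exact ⟨le_rfl, by positivity⟩

lemma continuous_gauss : Continuous fun t : ℝ => Real.exp (-t ^ 2 / 2) := by fun_prop

/-- Comparison of the Gaussian mass of the bulk with the number of points in it. -/
lemma IsGround.gauss_mass {N K : ℕ} {x : ℕ → ℝ} (hx : IsGround N x) (hK : 2 ≤ K)
    (hKN : (K : ℝ) ^ 4 ≤ N - 1) (h2K : 2 * K ≤ N) :
    S x ((N + 1) / 2) / ((N : ℝ) - 1) * Real.exp (-(4 / ((K : ℝ) - 1))) *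
        (∫ t in (- x K)..(x K), Real.exp (-t ^ 2 / 2)) ≤ 1 ∧
      1 - 2 / (K : ℝ) ≤ S x ((N + 1) / 2) / ((N : ℝ) - 1) * Real.exp (4 / ((K : ℝ) - 1)) *
        (∫ t in (- x K)..(x K), Real.exp (-t ^ 2 / 2)) := by
  have hK2 : (2 : ℝ) ≤ K := by exact_mod_cast hK
  have hN : 0 < (N : ℝ) - 1 := by
    have : 0 < (K : ℝ) ^ 4 := by positivity
    linarith
  have hint : ∀ a b : ℝ, IntervalIntegrable (fun t : ℝ => Real.exp (-t ^ 2 / 2)) volume a b :=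
    fun a b => continuous_gauss.intervalIntegrable a b
  set A := S x ((N + 1) / 2) / ((N : ℝ) - 1)
  set I : ℝ → ℝ → ℝ := fun a b => ∫ t in a..b, Real.exp (-t ^ 2 / 2) with hI
  set d := 4 / ((K : ℝ) - 1)
  have key : ∀ n, K ≤ n → n + K ≤ N + 1 →
      A * Real.exp (-d) * I (x n) (x K) ≤ ((n : ℝ) - K) / (N - 1) ∧
        ((n : ℝ) - K) / (N - 1) ≤ A * Real.exp d * I (x n) (x K) := by
    intro n hn
    induction n, hn using Nat.le_induction with
    | base => intro _; simp [hI]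
    | succ n hn ih =>
      intro hnN
      obtain ⟨ih1, ih2⟩ := ih (by omega)
      have hadd : I (x (n + 1)) (x K) = I (x (n + 1)) (x n) + I (x n) (x K) :=
        (intervalIntegral.integral_add_adjacent_intervals (hint _ _) (hint _ _)).symm
      have hle := (hx.lt_succ n (by omega) (by omega)).le
      have hp := hx.pos n (by omega) (by omega)
      have hone : (x n - x (n + 1)) * (S x n / ((N : ℝ) - 1)) = 1 / (N - 1) := by
        rw [hx.step n (by omega) (by omega)]
        field_simp
        ring
      have hconst : (∫ _ in (x (n + 1))..(x n), S x n / ((N : ℝ) - 1)) = 1 / (N - 1) := by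
        rw [intervalIntegral.integral_const, smul_eq_mul, hone]
      have hb := fun t (ht : t ∈ Set.Icc (x (n + 1)) (x n)) =>
        hx.density_bulk hK hKN hn (by omega) ht.1 ht.2
      have u1 : A * Real.exp (-d) * I (x (n + 1)) (x n) ≤ 1 / (N - 1) := by
        rw [← hconst, hI, ← intervalIntegral.integral_const_mul]
        exact intervalIntegral.integral_mono_on hle ((hint _ _).const_mul _)
          intervalIntegrable_const fun t ht => (hb t ht).1
      have u2 : 1 / (N - 1) ≤ A * Real.exp d * I (x (n + 1)) (x n) := by
        rw [← hconst, hI, ← intervalIntegral.integral_const_mul]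
        exact intervalIntegral.integral_mono_on hle intervalIntegrable_const
          ((hint _ _).const_mul _) fun t ht => (hb t ht).2
      have hc : (((n + 1 : ℕ) : ℝ) - K) / (N - 1) = 1 / (N - 1) + ((n : ℝ) - K) / (N - 1) := by
        push_cast; ring
      rw [hadd, hc, mul_add, mul_add]
      exact ⟨add_le_add u1 ih1, add_le_add u2 ih2⟩
  obtain ⟨k1, k2⟩ := key (N + 1 - K) (by omega) (by omega)
  rw [hx.x_symm K (by omega) (by omega), Nat.cast_sub (by omega)] at k1 k2
  push_cast at k1 k2
  refine ⟨k1.trans ?_, le_trans ?_ k2⟩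
  · rw [div_le_one hN]
    linarith
  · rw [le_div_iff₀ hN, sub_mul, one_mul, div_mul_eq_mul_div]
    have : 2 * (K : ℝ) ≤ 2 * (N - 1) / K := by
      rw [le_div_iff₀ (by linarith)]
      nlinarith [pow_le_pow_left₀ (by norm_num) hK2 2]
    linarith

lemma integrable_gauss : Integrable fun t : ℝ => Real.exp (-t ^ 2 / 2) := by
  have h := integrable_exp_neg_mul_sq (show (0 : ℝ) < 1 / 2 by norm_num)
  refine h.congr (Eventually.of_forall fun t => ?_)
  simp only
  congr 1
  ring

lemma integral_gauss : ∫ t : ℝ, Real.exp (-t ^ 2 / 2) = Real.sqrt (2 * Real.pi) := by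
  have h := integral_gaussian (1 / 2)
  rw [show Real.pi / (1 / 2) = 2 * Real.pi by ring] at h
  rw [← h]
  congr 1
  ext t
  congr 1
  ring

lemma gauss_interval_le {B : ℝ} (hB : 0 ≤ B) :
    ∫ t in (-B)..B, Real.exp (-t ^ 2 / 2) ≤ Real.sqrt (2 * Real.pi) := by
  rw [intervalIntegral.integral_of_le (by linarith), ← integral_gauss]
  exact setIntegral_le_integral integrable_gauss
    (Eventually.of_forall fun t => (Real.exp_pos _).le)

/-- Almost Gaussian profiles of height `A` and width `B` carrying almost unit mass and having
small boundary values are asymptotically normalised. -/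
lemma tendsto_height_and_boundary {k A B : ℕ → ℝ} (hk : Tendsto k atTop atTop)
    (hB : ∀ᶠ N in atTop, 0 ≤ B N) (hA : ∀ᶠ N in atTop, 0 < A N)
    (h1 : ∀ᶠ N in atTop, A N * Real.exp (-(4 / (k N - 1))) *
      (∫ t in (- B N)..(B N), Real.exp (-t ^ 2 / 2)) ≤ 1)
    (h2 : ∀ᶠ N in atTop, 1 - 2 / k N ≤ A N * Real.exp (4 / (k N - 1)) *
      (∫ t in (- B N)..(B N), Real.exp (-t ^ 2 / 2)))
    (h3 : ∀ᶠ N in atTop, A N * Real.exp (-(4 / (k N - 1))) * Real.exp (-(B N) ^ 2 / 2)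
      ≤ 1 / k N) :
    Tendsto A atTop (nhds (Real.sqrt (2 * Real.pi))⁻¹) ∧
      Tendsto (fun N => Real.exp (-(B N) ^ 2 / 2)) atTop (nhds 0) := by
  have hd : Tendsto (fun N => 4 / (k N - 1)) atTop (nhds 0) :=
    (tendsto_atTop_add_const_right _ (-1) hk).const_div_atTop 4
  have he : Tendsto (fun N => Real.exp (4 / (k N - 1))) atTop (nhds 1) := by
    simpa using hd.rexp
  have he' : Tendsto (fun N => Real.exp (-(4 / (k N - 1)))) atTop (nhds 1) := by
    simpa using hd.neg.rexp
  have hr : Tendsto (fun N => 1 - 2 / k N) atTop (nhds 1) := by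
    simpa using (hk.const_div_atTop 2).const_sub 1
  have hc : 0 < Real.sqrt (2 * Real.pi) := by positivity
  set c := Real.sqrt (2 * Real.pi)
  have hlow : ∀ᶠ N in atTop, c⁻¹ / 2 < A N := by
    have hl : Tendsto (fun N => (1 - 2 / k N) * Real.exp (-(4 / (k N - 1))) * c⁻¹) atTop
        (nhds c⁻¹) := by
      simpa using (hr.mul he').mul_const c⁻¹
    filter_upwards [hl.eventually (lt_mem_nhds (half_lt_self (inv_pos.2 hc))), hB, hA, h2]
      with N u1 u2 u3 u4
    refine u1.trans_le ?_
    have h5 : 1 - 2 / k N ≤ A N * Real.exp (4 / (k N - 1)) * c :=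
      u4.trans (mul_le_mul_of_nonneg_left (gauss_interval_le u2) (by positivity))
    calc (1 - 2 / k N) * Real.exp (-(4 / (k N - 1))) * c⁻¹
        ≤ A N * Real.exp (4 / (k N - 1)) * c * Real.exp (-(4 / (k N - 1))) * c⁻¹ := by gcongr
      _ = A N := by rw [Real.exp_neg]; field_simp
  have hbd : Tendsto (fun N => Real.exp (-(B N) ^ 2 / 2)) atTop (nhds 0) := by
    have hu : Tendsto (fun N => 2 * c * (1 / k N) * Real.exp (4 / (k N - 1))) atTop (nhds 0) := by
      simpa using ((hk.const_div_atTop 1).const_mul (2 * c)).mul he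
    refine squeeze_zero' (Eventually.of_forall fun N => (Real.exp_pos _).le) ?_ hu
    filter_upwards [hlow, h3] with N u1 u2
    have h5 : c⁻¹ / 2 * Real.exp (-(4 / (k N - 1))) * Real.exp (-(B N) ^ 2 / 2) ≤ 1 / k N :=
      le_trans (by gcongr) u2
    calc Real.exp (-(B N) ^ 2 / 2) = 2 * c * (c⁻¹ / 2 * Real.exp (-(4 / (k N - 1))) *
          Real.exp (-(B N) ^ 2 / 2)) * Real.exp (4 / (k N - 1)) := by
          rw [Real.exp_neg]; field_simp
      _ ≤ _ := by gcongr
  refine ⟨?_, hbd⟩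
  have hBtop : Tendsto B atTop atTop := by
    rw [Real.tendsto_exp_comp_nhds_zero] at hbd
    rw [tendsto_atTop]
    intro b
    filter_upwards [hbd.eventually (eventually_lt_atBot (-(|b| ^ 2) / 2)), hB] with N u1 u2
    have h5 : |b| < B N := lt_of_pow_lt_pow_left₀ 2 u2 (by linarith)
    exact (le_abs_self b).trans h5.le
  have hI : Tendsto (fun N => ∫ t in (- B N)..(B N), Real.exp (-t ^ 2 / 2)) atTop (nhds c) := by
    rw [show c = _ from integral_gauss.symm]
    exact intervalIntegral_tendsto_integral integrable_gauss
      (tendsto_neg_atTop_atBot.comp hBtop) hBtop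
  have hIpos := hI.eventually (lt_mem_nhds hc)
  have hl : Tendsto (fun N => (1 - 2 / k N) * Real.exp (-(4 / (k N - 1))) *
      (∫ t in (- B N)..(B N), Real.exp (-t ^ 2 / 2))⁻¹) atTop (nhds c⁻¹) := by
    simpa using (hr.mul he').mul (hI.inv₀ hc.ne')
  have hu : Tendsto (fun N => Real.exp (4 / (k N - 1)) *
      (∫ t in (- B N)..(B N), Real.exp (-t ^ 2 / 2))⁻¹) atTop (nhds c⁻¹) := by
    simpa using he.mul (hI.inv₀ hc.ne')
  refine tendsto_of_tendsto_of_tendsto_of_le_of_le' hl hu ?_ ?_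
  · filter_upwards [hIpos, h2] with N u1 u2
    rw [← div_eq_mul_inv, div_le_iff₀ u1]
    calc (1 - 2 / k N) * Real.exp (-(4 / (k N - 1)))
        ≤ A N * Real.exp (4 / (k N - 1)) * (∫ t in (- B N)..(B N), Real.exp (-t ^ 2 / 2)) *
          Real.exp (-(4 / (k N - 1))) := by gcongr
      _ = _ := by rw [Real.exp_neg]; field_simp
  · filter_upwards [hIpos, h1] with N u1 u2
    rw [← div_eq_mul_inv, le_div_iff₀ u1]
    calc A N * (∫ t in (- B N)..(B N), Real.exp (-t ^ 2 / 2))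
        = A N * Real.exp (-(4 / (k N - 1))) * (∫ t in (- B N)..(B N), Real.exp (-t ^ 2 / 2)) *
          Real.exp (4 / (k N - 1)) := by rw [Real.exp_neg]; field_simp
      _ ≤ 1 * Real.exp (4 / (k N - 1)) := by gcongr
      _ = _ := one_mul _

lemma tendsto_sqrt_sqrt_pred :
    Tendsto (fun N : ℕ => (N - 1).sqrt.sqrt) atTop atTop := by
  have h : Tendsto Nat.sqrt atTop atTop := tendsto_atTop.2 fun b =>
    (eventually_ge_atTop (b * b)).mono fun n hn => Nat.le_sqrt.2 hn
  exact h.comp (h.comp (tendsto_sub_atTop_nat 1))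

/-- As `N → ∞`, the densities `y_N` (built from the unique strictly decreasing zero-mean
solutions of the recursion) converge uniformly on `ℝ` to the standard normal density. -/
theorem yDen_tendstoUniformly_gaussian_density (x : ℕ → ℕ → ℝ)
    (hsol : ∀ N, 3 ≤ N → IsSolution N (x N))
    (hdec : ∀ N, 3 ≤ N → ∀ n, 1 ≤ n → n < N → x N (n + 1) < x N n)
    (hmean : ∀ N, 3 ≤ N → ∑ i ∈ Finset.Icc 1 N, x N i = 0) :
    TendstoUniformly (fun (N : ℕ) (t : ℝ) => yDen N (x N) t)
      (fun t : ℝ => (Real.sqrt (2 * Real.pi))⁻¹ * Real.exp (-t ^ 2 / 2)) atTop := by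
  have hx : ∀ N, 3 ≤ N → IsGround N (x N) := fun N hN =>
    (hsol N hN).isGround (hdec N hN) (hmean N hN)
  set K : ℕ → ℕ := fun N => (N - 1).sqrt.sqrt with hKdef
  have hK : Tendsto K atTop atTop := tendsto_sqrt_sqrt_pred
  have hk : Tendsto (fun N => (K N : ℝ)) atTop atTop := tendsto_natCast_atTop_atTop.comp hK
  set A : ℕ → ℝ := fun N => S (x N) ((N + 1) / 2) / ((N : ℝ) - 1) with hAdef
  set B : ℕ → ℝ := fun N => x N (K N) with hBdef
  have good : ∀ᶠ N in atTop, IsGround N (x N) ∧ 2 ≤ K N ∧ (K N : ℝ) ^ 4 ≤ N - 1 ∧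
      2 * K N ≤ N := by
    filter_upwards [eventually_ge_atTop 3, hK.eventually (eventually_ge_atTop 2)] with N h1 h2
    have h3 : K N ^ 2 ≤ (N - 1).sqrt := Nat.sqrt_le' _
    have h4 : (N - 1).sqrt ^ 2 ≤ N - 1 := Nat.sqrt_le' _
    have h5 : K N ^ 4 ≤ N - 1 := by
      calc K N ^ 4 = (K N ^ 2) ^ 2 := by ring
        _ ≤ (N - 1).sqrt ^ 2 := by gcongr
        _ ≤ N - 1 := h4
    have h6 : 2 * K N ≤ K N ^ 4 := by
      nlinarith [Nat.pow_le_pow_left h2 3]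
    refine ⟨hx N h1, h2, ?_, by omega⟩
    have h7 : (K N : ℝ) ^ 4 ≤ ((N - 1 : ℕ) : ℝ) := by exact_mod_cast h5
    rwa [Nat.cast_sub (by omega), Nat.cast_one] at h7
  have hApos : ∀ᶠ N in atTop, 0 < A N := by
    filter_upwards [good] with N ⟨h1, h2, h3, h4⟩
    have : (1 : ℝ) < N := by exact_mod_cast (show 1 < N by omega)
    exact div_pos (h1.pos _ (by omega) (by omega)) (by linarith)
  obtain ⟨hA, hbd⟩ := tendsto_height_and_boundary (k := fun N => (K N : ℝ)) (A := A) (B := B) hk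
    (good.mono fun N ⟨h1, h2, h3, h4⟩ => h1.nonneg _ (by omega) (by omega)) hApos
    (good.mono fun N ⟨h1, h2, h3, h4⟩ => (h1.gauss_mass h2 h3 h4).1)
    (good.mono fun N ⟨h1, h2, h3, h4⟩ => (h1.gauss_mass h2 h3 h4).2)
    (good.mono fun N ⟨h1, h2, h3, h4⟩ =>
      (h1.density_bulk h2 h3 le_rfl (by omega) (h1.lt_succ _ (by omega) (by omega)).le
        le_rfl).1.trans (h1.density_tail h2 h3 (by omega) (by omega) (Or.inl le_rfl)))
  have hd : Tendsto (fun N => 4 / ((K N : ℝ) - 1)) atTop (nhds 0) :=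
    (tendsto_atTop_add_const_right _ (-1) hk).const_div_atTop 4
  have hup : Tendsto (fun N => A N * Real.exp (4 / ((K N : ℝ) - 1))) atTop
      (nhds (Real.sqrt (2 * Real.pi))⁻¹) := by
    simpa using hA.mul hd.rexp
  have hlo : Tendsto (fun N => A N * Real.exp (-(4 / ((K N : ℝ) - 1)))) atTop
      (nhds (Real.sqrt (2 * Real.pi))⁻¹) := by
    simpa using hA.mul hd.neg.rexp
  have hbd' := hbd.const_mul (Real.sqrt (2 * Real.pi))⁻¹
  rw [mul_zero] at hbd'
  have hc : 0 < (Real.sqrt (2 * Real.pi))⁻¹ := by positivity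
  set c := (Real.sqrt (2 * Real.pi))⁻¹
  rw [Metric.tendstoUniformly_iff]
  intro ε hε
  filter_upwards [good, hup.eventually (gt_mem_nhds (show c < c + ε by linarith)),
    hlo.eventually (lt_mem_nhds (show c - ε < c by linarith)),
    hbd'.eventually (gt_mem_nhds hε), (hk.const_div_atTop 1).eventually (gt_mem_nhds hε),
    good.mono fun N ⟨h1, h2, h3, h4⟩ => h1.nonneg (K N) (by omega) (by omega)]
    with N ⟨h1, h2, h3, h4⟩ u1 u2 u3 u4 u5 t
  have hG : 0 < Real.exp (-t ^ 2 / 2) := Real.exp_pos _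
  rw [Real.dist_eq, abs_sub_lt_iff]
  by_cases ht : - x N (K N) ≤ t ∧ t < x N (K N)
  · obtain ⟨b1, b2⟩ := h1.yDen_bulk h2 h3 h4 ht.1 ht.2
    have hG1 : Real.exp (-t ^ 2 / 2) ≤ 1 := Real.exp_le_one_iff.2 (by nlinarith [sq_nonneg t])
    have hεG : ε * Real.exp (-t ^ 2 / 2) ≤ ε := mul_le_of_le_one_right hε.le hG1
    have v1 := mul_lt_mul_of_pos_right u1 hG
    have v2 := mul_lt_mul_of_pos_right u2 hG
    rw [add_mul] at v1
    rw [sub_mul] at v2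
    simp only [hAdef] at v1 v2
    constructor <;> linarith
  · have ht' : t < - x N (K N) ∨ x N (K N) ≤ t := by
      by_contra! h
      exact ht h
    obtain ⟨b1, b2⟩ := h1.yDen_tail h2 h3 h4 ht'
    have ht2 : x N (K N) ^ 2 ≤ t ^ 2 := by
      rcases ht' with h | h <;> nlinarith
    have hle : Real.exp (-t ^ 2 / 2) ≤ Real.exp (-(x N (K N)) ^ 2 / 2) :=
      Real.exp_le_exp.2 (by linarith)
    have v := mul_le_mul_of_nonneg_left hle hc.le
    have v0 : 0 < c * Real.exp (-t ^ 2 / 2) := mul_pos hc hG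
    simp only [hBdef] at u3
    constructor <;> linarith
end
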